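/- arXiv:1410.8770 — 2 statements merged into one kernel-verified Lean document; each statement's English description precedes it below -/
import Mathlib

section
/- For all complex numbers d₀₀, d₀₁, d₀₂, d₁₁, d₁₂, d₂₂, the 9×9 matrix H with rows (d₀₁, d₀₁, 0, −2d₀₀, 0, 0, 0, 0, 0), (0, 2d₁₁, 0, −d₀₁, −d₀₁, 0, 0, 0, 0), (0, d₁₂, d₁₂, −d₀₂, 0, −d₀₂, 0, 0, 0), (d₀₂, 0, d₀₂, 0, 0, 0, −2d₀₀, 0, 0), (0, d₁₂, d₁₂, 0, 0, 0, −d₀₁, −d₀₁, 0), (0, 0, 2d₂₂, 0, 0, 0, −d₀₂, 0, −d₀₂), (0, 0, 0, d₀₂, 0, d₀₂, −d₀₁, −d₀₁, 0), (0, 0, 0, 0, d₁₂, d₁₂, 0, −2d₁₁, 0), (0, 0, 0, 0, 0, 2d₂₂, 0, −d₁₂, −d₁₂) has determinant zero; equivalently, rank H ≤ 8, so the homogeneous linear system with coefficient matrix H has a nonzero solution. -/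
/-- The 9×9 Schwarz-compatibility matrix `H` attached to a quadratic form with
coefficients `d_{ij}` has determinant zero; equivalently its rank is at most 8,
so the homogeneous linear system `H v = 0` has a nonzero solution. -/
theorem stmt_4 (d₀₀ d₀₁ d₀₂ d₁₁ d₁₂ d₂₂ : ℂ)
    (H : Matrix (Fin 9) (Fin 9) ℂ)
    (hH : H = !![d₀₁, d₀₁, 0, -2*d₀₀, 0, 0, 0, 0, 0;
                 0, 2*d₁₁, 0, -d₀₁, -d₀₁, 0, 0, 0, 0;
                 0, d₁₂, d₁₂, -d₀₂, 0, -d₀₂, 0, 0, 0;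
                 d₀₂, 0, d₀₂, 0, 0, 0, -2*d₀₀, 0, 0;
                 0, d₁₂, d₁₂, 0, 0, 0, -d₀₁, -d₀₁, 0;
                 0, 0, 2*d₂₂, 0, 0, 0, -d₀₂, 0, -d₀₂;
                 0, 0, 0, d₀₂, 0, d₀₂, -d₀₁, -d₀₁, 0;
                 0, 0, 0, 0, d₁₂, d₁₂, 0, -2*d₁₁, 0;
                 0, 0, 0, 0, 0, 2*d₂₂, 0, -d₁₂, -d₁₂]) :
    H.det = 0 ∧ H.rank ≤ 8 ∧ ∃ v : Fin 9 → ℂ, v ≠ 0 ∧ H.mulVec v = 0 := by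
  have hw : ∃ w : Fin 9 → ℂ, w ≠ 0 ∧ Matrix.vecMul w H = 0 := by
    refine ⟨![0, 0, 1, 0, -1, 0, 1, 0, 0], fun h => by simpa using congrFun h 2, ?_⟩
    ext j
    fin_cases j <;> simp [hH, Matrix.vecMul, dotProduct, Fin.sum_univ_succ]
  have hdet : H.det = 0 := Matrix.exists_vecMul_eq_zero_iff.mp hw
  have hv := Matrix.exists_mulVec_eq_zero_iff.mpr hdet
  refine ⟨hdet, ?_, hv⟩
  obtain ⟨v, hv0, hv⟩ := hv
  have hker : 0 < Module.finrank ℂ (LinearMap.ker H.mulVecLin) :=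
    Module.finrank_pos_iff_exists_ne_zero.mpr
      ⟨⟨v, by simpa using hv⟩, fun h => hv0 (congrArg Subtype.val h)⟩
  have hsum := LinearMap.finrank_range_add_finrank_ker H.mulVecLin
  rw [Module.finrank_fin_fun] at hsum
  rw [Matrix.rank]
  omega
end

section
/- Let (d_{ij}) (0 ≤ i, j ≤ 2) be a symmetric 3×3 matrix over ℂ and set f₄ = Σ_{i,j=0}^{2} d_{ij} x_i x_j ∈ ℂ[x₀, x₁, x₂]. Then there exist a nonzero matrix (e_j^i) ∈ M₃(ℂ) and a homogeneous polynomial g ∈ ℂ[x₀, x₁, x₂] of degree 3 such that, for every i ∈ {0, 1, 2}, ∂_i g = Σ_{j=0}^{2} e_j^i · (x_j · ∂_j f₄). -/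
open MvPolynomial

/-- The linear conditions on `e` expressing that the vector field with components
`∑ j, e i j * x_j * ∂_j f` is curl-free, where `f` is the quadratic form with matrix `d`;
one redundant condition is left out. -/
def curlConditions (d : Matrix (Fin 3) (Fin 3) ℂ) :
    Matrix (Fin 3) (Fin 3) ℂ →ₗ[ℂ] (Fin 8 → ℂ) where
  toFun e := ![
    d 0 1 * (e 0 0 + e 0 1) - 2 * d 0 0 * e 1 0,
    d 0 1 * (e 1 0 + e 1 1) - 2 * d 1 1 * e 0 1,
    d 0 2 * (e 0 0 + e 0 2) - 2 * d 0 0 * e 2 0,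
    d 0 2 * (e 2 0 + e 2 2) - 2 * d 2 2 * e 0 2,
    d 1 2 * (e 1 1 + e 1 2) - 2 * d 1 1 * e 2 1,
    d 1 2 * (e 2 1 + e 2 2) - 2 * d 2 2 * e 1 2,
    d 1 2 * (e 0 1 + e 0 2) - d 0 2 * (e 1 0 + e 1 2),
    d 1 2 * (e 0 1 + e 0 2) - d 0 1 * (e 2 0 + e 2 1)]
  map_add' e e' := by
    ext i; fin_cases i <;> simp <;> ring
  map_smul' c e := by
    ext i; fin_cases i <;> simp <;> ring

theorem exists_ne_zero_curlConditions_eq_zero (d : Matrix (Fin 3) (Fin 3) ℂ) :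
    ∃ e : Matrix (Fin 3) (Fin 3) ℂ, e ≠ 0 ∧ curlConditions d e = 0 := by
  have h : LinearMap.ker (curlConditions d) ≠ ⊥ :=
    LinearMap.ker_ne_bot_of_finrank_lt (by simp [Module.finrank_matrix])
  obtain ⟨e, he, hne⟩ := Submodule.exists_mem_ne_zero_of_ne_bot h
  exact ⟨e, hne, he⟩

theorem isHomogeneous_C_mul_X_mul_X_mul_X {σ R : Type*} [CommSemiring R] (c : R) (i j k : σ) :
    (C c * (X i * X j * X k) : MvPolynomial σ R).IsHomogeneous 3 := by
  simpa using (isHomogeneous_C σ c).mul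
    (((isHomogeneous_X R i).mul (isHomogeneous_X R j)).mul (isHomogeneous_X R k))

/-- For any quadratic form `f₄ = Σ d_{ij} xᵢ xⱼ` with symmetric coefficient matrix,
there exist a nonzero matrix `(e_j^i)` of constants and a homogeneous cubic `g` with
`∂ᵢ g = Σ_j e_j^i · (x_j ∂_j f₄)` for every `i`. -/
theorem stmt_6 (d : Matrix (Fin 3) (Fin 3) ℂ) (hd : d.IsSymm)
    (f₄ : MvPolynomial (Fin 3) ℂ)
    (hf₄ : f₄ = ∑ i : Fin 3, ∑ j : Fin 3, C (d i j) * X i * X j) :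
    ∃ e : Matrix (Fin 3) (Fin 3) ℂ, e ≠ 0 ∧
      ∃ g : MvPolynomial (Fin 3) ℂ, g.IsHomogeneous 3 ∧
        ∀ i : Fin 3, pderiv i g = ∑ j : Fin 3, C (e i j) * (X j * pderiv j f₄) := by
  obtain ⟨e, hne, he⟩ := exists_ne_zero_curlConditions_eq_zero d
  have key (i : Fin 8) := congrArg (C (σ := Fin 3)) (congrFun he i)
  have h0 := key 0
  have h1 := key 1
  have h2 := key 2
  have h3 := key 3
  have h4 := key 4
  have h5 := key 5
  have h6 := key 6
  have h7 := key 7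
  have two : (C 2 : MvPolynomial (Fin 3) ℂ) = 2 := map_ofNat C 2
  simp [curlConditions, two] at h0 h1 h2 h3 h4 h5 h6 h7
  have third (i : Fin 3) : ∃ t : ℂ, (3 * C t : MvPolynomial (Fin 3) ℂ) = C (d i i) * C (e i i) := by
    refine ⟨d i i * e i i / 3, ?_⟩
    rw [← map_ofNat C 3, ← C_mul, ← C_mul]
    congr 1
    ring
  choose t ht using third
  have ht0 := ht 0
  have ht1 := ht 1
  have ht2 := ht 2
  refine ⟨e, hne,
    C (2 * t 0) * (X 0 * X 0 * X 0) + C (2 * t 1) * (X 1 * X 1 * X 1)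
    + C (2 * t 2) * (X 2 * X 2 * X 2)
    + C (d 0 1 * (e 0 0 + e 0 1)) * (X 0 * X 0 * X 1)
    + C (d 0 2 * (e 0 0 + e 0 2)) * (X 0 * X 0 * X 2)
    + C (d 0 1 * (e 1 0 + e 1 1)) * (X 1 * X 1 * X 0)
    + C (d 1 2 * (e 1 1 + e 1 2)) * (X 1 * X 1 * X 2)
    + C (d 0 2 * (e 2 0 + e 2 2)) * (X 2 * X 2 * X 0)
    + C (d 1 2 * (e 2 1 + e 2 2)) * (X 2 * X 2 * X 1)
    + C (2 * (d 1 2 * (e 0 1 + e 0 2))) * (X 0 * X 1 * X 2), ?_, ?_⟩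
  · repeat' apply IsHomogeneous.add
    all_goals apply isHomogeneous_C_mul_X_mul_X_mul_X
  · have d10 : d 1 0 = d 0 1 := hd.apply 0 1
    have d20 : d 2 0 = d 0 2 := hd.apply 0 2
    have d21 : d 2 1 = d 1 2 := hd.apply 1 2
    have pderiv_two (i : Fin 3) : pderiv i (2 : MvPolynomial (Fin 3) ℂ) = 0 := by
      rw [← two, pderiv_C]
    subst hf₄
    intro i
    fin_cases i <;>
      simp [Fin.sum_univ_three, Derivation.leibniz, pderiv_X, Pi.single_apply, d10, d20, d21, two,
        pderiv_two]
    · linear_combination 2 * X 0 ^ 2 * ht0 + X 1 ^ 2 * h1 + X 2 ^ 2 * h3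
    · linear_combination 2 * X 1 ^ 2 * ht1 + X 0 ^ 2 * h0 + X 2 ^ 2 * h5 + 2 * X 0 * X 2 * h6
    · linear_combination 2 * X 2 ^ 2 * ht2 + X 0 ^ 2 * h2 + X 1 ^ 2 * h4 + 2 * X 0 * X 1 * h7
end
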